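/- With the punishment profile τ constructed from ρ*, L, σ_{-i} and σ^∞_{-i}: for every player i, every strategy τ'_i of player i, and every state s ∈ S^∞ with i(s) = i such that L(s) = ⊥ and τ'_i(s) ∈ A^∞(s) ∖ {ρ*_i(s)}, one has u_i(τ'_i, τ_{-i} | s) ≤ u_i(τ | s). -/

import Mathlib

open MeasureTheory

/-- A multi-player perfect-information game with probabilistic transitions:
a set of players `N`, a state space `S` with initial state `init`, a controlling
player `ctrl s` and a nonempty finite action set `act s` for every state `s`, and
a transition probability measure `q s a` for every state `s` and action `a`.
The supports of the transition measures are mutually disjoint and every state is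
reachable from the initial state, so every state is reached from `init` via
exactly one finite history (states correspond bijectively to histories). -/
structure PGame (N S A : Type*) where
  init : S
  ctrl : S → N
  act : S → Finset A
  act_nonempty : ∀ s, (act s).Nonempty
  q : S → A → PMF S
  unique_pred : ∀ z s a s' a', a ∈ act s → a' ∈ act s' →
    z ∈ (q s a).support → z ∈ (q s' a').support → s = s' ∧ a = a'
  init_not_succ : ∀ s a, a ∈ act s → init ∉ (q s a).support
  reach : ∀ z, Relation.ReflTransGen (fun s t => ∃ a ∈ act s, t ∈ (q s a).support) init z

namespace PGame

variable {N S A : Type*} (G : PGame N S A)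

/-- A play: an infinite alternating sequence of states and actions, starting at the
initial state, choosing legal actions and moving to successor states. -/
def IsPlay (p : ℕ → S × A) : Prop :=
  (p 0).1 = G.init ∧
    ∀ m, (p m).2 ∈ G.act (p m).1 ∧ (p (m + 1)).1 ∈ (G.q (p m).1 (p m).2).support

/-- The set of plays of the game. -/
def Play : Type _ := { p : ℕ → S × A // G.IsPlay p }

/-- The set of plays carries the topology generated by the cylinder sets, i.e. the
topology induced by the product of the discrete topologies. -/
instance : TopologicalSpace G.Play :=
  letI : TopologicalSpace S := ⊥
  letI : TopologicalSpace A := ⊥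
  inferInstanceAs (TopologicalSpace { p : ℕ → S × A // G.IsPlay p })

/-- The Borel σ-algebra on plays. -/
instance : MeasurableSpace G.Play := borel G.Play

/-- A strategy of player `i`: a choice of a legal action in every state controlled
by `i`. -/
def Strat (i : N) : Type _ := { f : S → A // ∀ s, G.ctrl s = i → f s ∈ G.act s }

/-- A strategy profile. -/
def Profile : Type _ := ∀ i : N, G.Strat i

/-- The profile `σ` with player `i`'s strategy replaced by `τi`. -/
noncomputable def comb (i : N) (τi : G.Strat i) (σ : G.Profile) : G.Profile :=
  haveI := Classical.decEq N
  Function.update σ i τi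

/-- The action that profile `σ` plays in state `s`. -/
def playFun (σ : G.Profile) (s : S) : A := (σ (G.ctrl s)).1 s

/-- The cylinder set of plays agreeing with the play `p0` on the first `n`
coordinates. -/
def cylSet (p0 : G.Play) (n : ℕ) : Set G.Play := { p : G.Play | ∀ m < n, p.1 m = p0.1 m }

open Classical in
/-- `μ` is the family of Borel probability measures on plays induced by the strategy
profiles via the Ionescu–Tulcea construction applied to `q`; it is uniquely
characterized by the probabilities it assigns to the cylinder sets: actions are
chosen deterministically according to the profile and states are drawn from the
transition probabilities. -/
def IsInducedMeasure (μ : G.Profile → Measure G.Play) : Prop :=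
  (∀ σ, IsProbabilityMeasure (μ σ)) ∧
    ∀ (σ : G.Profile) (p0 : G.Play) (n : ℕ),
      μ σ (G.cylSet p0 n) =
        ∏ m ∈ Finset.range n,
          ((if (p0.1 m).2 = G.playFun σ (p0.1 m).1 then 1 else 0) *
            (if m + 1 < n then G.q (p0.1 m).1 (p0.1 m).2 ((p0.1 (m + 1)).1) else 1))

/-- Expected payoff of player `i` under the profile `σ`: the integral of `u i`
against the induced measure. -/
noncomputable def epay (μ : G.Profile → Measure G.Play) (u : N → G.Play → ℝ)
    (σ : G.Profile) (i : N) : ℝ :=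
  ∫ p, u i p ∂(μ σ)

/-- Nash equilibrium: no player can improve his expected payoff by a unilateral
deviation. -/
def IsNash (μ : G.Profile → Measure G.Play) (u : N → G.Play → ℝ) (σ : G.Profile) : Prop :=
  ∀ (i : N) (τi : G.Strat i), G.epay μ u (G.comb i τi σ) i ≤ G.epay μ u σ i

/-- Secure equilibrium: a Nash equilibrium such that no player `i` has a deviation
keeping his own expected payoff equal, making all opponents weakly worse off, and
making some opponent strictly worse off. -/
def IsSecure (μ : G.Profile → Measure G.Play) (u : N → G.Play → ℝ) (σ : G.Profile) : Prop :=
  G.IsNash μ u σ ∧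
    ¬ ∃ (i : N) (τi : G.Strat i),
        G.epay μ u (G.comb i τi σ) i = G.epay μ u σ i ∧
        (∀ j : N, j ≠ i → G.epay μ u (G.comb i τi σ) j ≤ G.epay μ u σ j) ∧
        (∃ k : N, k ≠ i ∧ G.epay μ u (G.comb i τi σ) k < G.epay μ u σ k)

/-- One-step successor relation between states. -/
def step (s t : S) : Prop := ∃ a ∈ G.act s, t ∈ (G.q s a).support

/-- The set of plays that pass through the state `s` (i.e. the plays extending the
unique history from the initial state to `s`). -/
def through (s : S) : Set G.Play := { p : G.Play | ∃ n, (p.1 n).1 = s }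

/-- `E` is the family of subgame expected payoffs: `E σ s i` is the expected payoff
`u_i(σ|s)` of player `i` in the subgame `G(s)` starting from state `s`, under the
profile `σ`.  It is characterized as follows: `E σ s i` only depends on the actions
of `σ` in the subtree rooted at `s`, and for any profile `τ` agreeing with `σ`
there, the integral of `u_i` over the set of plays through `s` under the measure
induced by `τ` equals `E σ s i` times the probability of reaching `s` under `τ`. -/
def IsSubgamePayoff (μ : G.Profile → Measure G.Play) (u : N → G.Play → ℝ)
    (E : G.Profile → S → N → ℝ) : Prop :=
  ∀ (σ τ : G.Profile) (s : S) (i : N),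
    (∀ z, Relation.ReflTransGen G.step s z → G.playFun τ z = G.playFun σ z) →
    ∫ p in G.through s, u i p ∂(μ τ) = E σ s i * (μ τ (G.through s)).toReal
/-- One-step successor relation using only actions in the restricted action sets
`B`. -/
def stepIn (B : S → Set A) (s t : S) : Prop := ∃ a ∈ B s, t ∈ (G.q s a).support

/-- The value `v_i(s)` for player `i` of the zero-sum subgame from `s` of the game
restricted to the action sets `B`: player `i` maximizes the expectation of `u_i`
over his strategies playing in `B` (on the states reachable from `s` via
`B`-actions), while the coalition of his opponents jointly minimizes it over their
strategies playing in `B` there. -/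
noncomputable def rval (E : G.Profile → S → N → ℝ) (B : S → Set A) (s : S) (i : N) : ℝ :=
  ⨆ τi : { f : G.Strat i //
      ∀ z, Relation.ReflTransGen (G.stepIn B) s z → G.ctrl z = i → f.1 z ∈ B z },
    ⨅ τo : { g : G.Profile //
      ∀ z, Relation.ReflTransGen (G.stepIn B) s z → G.ctrl z ≠ i → G.playFun g z ∈ B z },
      E (G.comb i τi.1 τo.1) s i

/-- `v_i(s,a) = ∑_{z ∈ S(s,a)} q(s,a)(z) · v_i(z)` in the game restricted to the
action sets `B`. -/
noncomputable def rvalQ (E : G.Profile → S → N → ℝ) (B : S → Set A)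
    (s : S) (a : A) (i : N) : ℝ :=
  ∑' z : S, ((G.q s a) z).toReal * G.rval E B z i

/-- The elimination procedure: `Ak E 0 = A`, and `Ak E (k+1) s` consists of the
actions of `Ak E k s` that are optimal for the controlling player in the game
`G^k` restricted to the action sets `Ak E k`, i.e. such that
`v^k_{i(s)}(s,a) = v^k_{i(s)}(s)`. -/
noncomputable def Ak (E : G.Profile → S → N → ℝ) (k : ℕ) : S → Set A :=
  Nat.rec (motive := fun _ => S → Set A)
    (fun s => (G.act s : Set A))
    (fun _ B s =>
      { a ∈ B s | G.rvalQ E B s a (G.ctrl s) = G.rval E B s (G.ctrl s) })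
    k

/-- `Sk E k` is the state space `S^k` of the game `G^k`: the set of states
reachable from the initial state using only actions in the sets `Ak E k`. -/
def Sk (E : G.Profile → S → N → ℝ) (k : ℕ) : Set S :=
  { z | Relation.ReflTransGen (G.stepIn (G.Ak E k)) G.init z }

/-- `S^∞ = ⋂_k S^k`. -/
def Sinf (E : G.Profile → S → N → ℝ) : Set S := ⋂ k, G.Sk E k

/-- `A^∞(s) = ⋂_k A^k(s)`. -/
def Ainf (E : G.Profile → S → N → ℝ) (s : S) : Set A := ⋂ k, G.Ak E k s
end PGame

namespace PGame

section Aux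

variable {N S A : Type*} (G : PGame N S A)

theorem play_uniq (p p' : G.Play) : ∀ n n' : ℕ, (p.1 n).1 = (p'.1 n').1 →
    n = n' ∧ ∀ m < n, p.1 m = p'.1 m := by
  intro n
  induction n with
  | zero =>
    intro n' h
    cases n' with
    | zero => exact ⟨rfl, fun m hm => absurd hm (by omega)⟩
    | succ k =>
      exfalso
      rw [p.2.1] at h
      have := p'.2.2 k
      rw [← h] at this
      exact G.init_not_succ _ _ this.1 this.2
  | succ n ih =>
    intro n' h
    cases n' with
    | zero =>
      exfalso
      rw [p'.2.1] at h
      have := p.2.2 n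
      rw [h] at this
      exact G.init_not_succ _ _ this.1 this.2
    | succ k =>
      have h1 := p.2.2 n
      have h2 := p'.2.2 k
      rw [h] at h1
      obtain ⟨e1, e2⟩ := G.unique_pred _ _ _ _ _ h1.1 h2.1 h1.2 h2.2
      obtain ⟨e3, e4⟩ := ih k e1
      refine ⟨by omega, fun m hm => ?_⟩
      rcases Nat.lt_succ_iff_lt_or_eq.1 hm with h' | h'
      · exact e4 m h'
      · subst h'
        subst e3
        exact Prod.ext e1 e2

theorem subtree_depth (p : G.Play) (n : ℕ) (z : S)
    (h : Relation.ReflTransGen G.step (p.1 n).1 z) :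
    ∀ (p' : G.Play) (m : ℕ), (p'.1 m).1 = z → n ≤ m := by
  induction h with
  | refl => intro p' m h; exact (G.play_uniq p p' n m h.symm).1.le
  | tail hy hz ih =>
    intro p' m h
    obtain ⟨a, ha, hz⟩ := hz
    cases m with
    | zero =>
      rw [p'.2.1] at h
      rw [← h] at hz
      exact absurd hz (G.init_not_succ _ _ ha)
    | succ k =>
      have h1 := p'.2.2 k
      rw [h] at h1
      obtain ⟨e1, e2⟩ := G.unique_pred _ _ _ _ _ h1.1 ha h1.2 hz
      exact (ih p' k e1).trans (Nat.le_succ k)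

theorem partial_play (z : S) : ∃ (n : ℕ) (p : ℕ → S × A), (p 0).1 = G.init ∧ (p n).1 = z ∧
    ∀ m < n, (p m).2 ∈ G.act (p m).1 ∧ (p (m + 1)).1 ∈ (G.q (p m).1 (p m).2).support := by
  induction G.reach z with
  | refl =>
    obtain ⟨a, ha⟩ := G.act_nonempty G.init
    exact ⟨0, fun _ => (G.init, a), rfl, rfl, fun m hm => absurd hm (by omega)⟩
  | @tail y z _ hz ih =>
    obtain ⟨n, p, h0, hn, hp⟩ := ih
    obtain ⟨a, ha, hz⟩ := hz
    refine ⟨n + 1, fun m => if m < n then p m else if m = n then (y, a) else (z, a), ?_, ?_, ?_⟩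
    · by_cases h : 0 < n
      · simp [h, h0]
      · have : n = 0 := by omega
        subst this
        simp [← hn, h0]
    · simp
    · intro m hm
      rcases Nat.lt_succ_iff_lt_or_eq.1 hm with h' | h'
      · have := hp m h'
        by_cases h2 : m + 1 < n
        · simpa [h', h2] using this
        · have h3 : m + 1 = n := by omega
          rw [h3, hn] at this
          simpa [h', h3] using this
      · subst h'
        simpa using ⟨ha, hz⟩

theorem exists_play (f : S → A) (g : S → S) (hf : ∀ s, f s ∈ G.act s)
    (hg : ∀ s, g s ∈ (G.q s (f s)).support) (z : S) :
    ∃ (p : G.Play) (n : ℕ), (p.1 n).1 = z ∧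
      ∀ m, n ≤ m → (p.1 m).2 = f (p.1 m).1 ∧ (p.1 (m + 1)).1 = g (p.1 m).1 := by
  obtain ⟨n, p, h0, hn, hp⟩ := G.partial_play z
  have key : ∀ m, n ≤ m → g (g^[m - n] z) = g^[m + 1 - n] z := by
    intro m hm
    rw [Nat.succ_sub hm, Function.iterate_succ_apply']
  let p' : ℕ → S × A := fun m => if m < n then p m else (g^[m - n] z, f (g^[m - n] z))
  have hlt : ∀ m, m < n → p' m = p m := fun m hm => by simp [p', hm]
  have hge : ∀ m, n ≤ m → p' m = (g^[m - n] z, f (g^[m - n] z)) := fun m hm => by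
    simp [p', not_lt.2 hm]
  refine ⟨⟨p', ?_, ?_⟩, n, ?_, ?_⟩
  · by_cases h : 0 < n
    · rw [hlt 0 h, h0]
    · have : n = 0 := by omega
      subst this
      rw [hge 0 le_rfl]
      simp [← hn, h0]
  · intro m
    by_cases h : m < n
    · have := hp m h
      by_cases h2 : m + 1 < n
      · rw [hlt m h, hlt _ h2]; exact this
      · have h3 : m + 1 = n := by omega
        rw [h3, hn] at this
        rw [hlt m h, hge (m+1) h3.ge]
        simpa [h3] using this
    · have h := not_lt.1 h
      rw [hge m h, hge (m+1) (by omega)]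
      refine ⟨hf _, ?_⟩
      have := hg (g^[m - n] z)
      rwa [key m h] at this
  · change (p' n).1 = z
    rw [hge n le_rfl]; simp
  · intro m hm
    change (p' m).2 = f (p' m).1 ∧ (p' (m + 1)).1 = g (p' m).1
    rw [hge m hm, hge (m+1) (by omega)]
    exact ⟨rfl, (key m hm).symm⟩

theorem exists_play' (f : S → A) (hf : ∀ s, f s ∈ G.act s) (z : S) :
    ∃ (p : G.Play) (n : ℕ), (p.1 n).1 = z ∧
      ∀ m, n ≤ m → (p.1 m).2 = f (p.1 m).1 := by
  have : ∀ s, ∃ z, z ∈ (G.q s (f s)).support := fun s => (G.q s (f s)).support_nonempty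
  choose g hg using this
  obtain ⟨p, n, h1, h2⟩ := G.exists_play f g hf hg z
  exact ⟨p, n, h1, fun m hm => (h2 m hm).1⟩

theorem playFun_mem (σ : G.Profile) (s : S) : G.playFun σ s ∈ G.act s :=
  (σ (G.ctrl s)).2 s rfl

theorem through_nonempty (z : S) : (G.through z).Nonempty := by
  choose f hf using G.act_nonempty
  obtain ⟨p, n, h, _⟩ := G.exists_play' f hf z
  exact ⟨p, n, h⟩

theorem through_sub {s : S} {a : A} (ha : a ∈ G.act s) {z : S} (hz : z ∈ (G.q s a).support) :
    ∀ p : G.Play, ∀ n, (p.1 n).1 = z → ∃ k, n = k + 1 ∧ (p.1 k) = (s, a) := by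
  intro p n h
  cases n with
  | zero =>
    rw [p.2.1] at h
    rw [← h] at hz
    exact absurd hz (G.init_not_succ _ _ ha)
  | succ k =>
    have h1 := p.2.2 k
    rw [h] at h1
    obtain ⟨e1, e2⟩ := G.unique_pred _ _ _ _ _ h1.1 ha h1.2 hz
    exact ⟨k, rfl, Prod.ext e1 e2⟩

theorem eval_open (n : ℕ) (T : Set (S × A)) : IsOpen {p : G.Play | p.1 n ∈ T} := by
  letI : TopologicalSpace S := ⊥
  letI : TopologicalSpace A := ⊥
  haveI : DiscreteTopology S := ⟨rfl⟩
  haveI : DiscreteTopology A := ⟨rfl⟩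
  have h1 : Continuous (fun p : { p : ℕ → S × A // G.IsPlay p } => p.1 n) :=
    (continuous_apply n).comp continuous_subtype_val
  exact (isOpen_discrete T).preimage h1

instance : BorelSpace G.Play := ⟨rfl⟩

theorem through_meas (s : S) : MeasurableSet (G.through s) := by
  have : G.through s = ⋃ n, {p : G.Play | p.1 n ∈ {x : S × A | x.1 = s}} := by
    ext p; simp [through]
  rw [this]
  exact (isOpen_iUnion fun n => G.eval_open n _).measurableSet

theorem cyl_meas (p : G.Play) (n : ℕ) : MeasurableSet (G.cylSet p n) := by
  have : G.cylSet p n = ⋂ m, ⋂ (_ : m < n), {p' : G.Play | p'.1 m ∈ ({p.1 m} : Set (S × A))} := by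
    ext p; simp [cylSet]
  rw [this]
  exact MeasurableSet.iInter fun m => MeasurableSet.iInter fun _ =>
    (G.eval_open m _).measurableSet

theorem cont_cyl (u : G.Play → ℝ) (hu : Continuous u) (p : G.Play) (ε : ℝ) (hε : 0 < ε) :
    ∃ n, ∀ p' : G.Play, (∀ m < n, p'.1 m = p.1 m) → |u p' - u p| < ε := by
  letI : TopologicalSpace S := ⊥
  letI : TopologicalSpace A := ⊥
  haveI : DiscreteTopology S := ⟨rfl⟩
  haveI : DiscreteTopology A := ⟨rfl⟩
  have hO : IsOpen (u ⁻¹' Metric.ball (u p) ε) := Metric.isOpen_ball.preimage hu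
  have hO' : ∃ V : Set (ℕ → S × A), IsOpen V ∧ (Subtype.val : G.Play → _) ⁻¹' V =
    u ⁻¹' Metric.ball (u p) ε := hO
  obtain ⟨V, hV, hVe⟩ := hO'
  have hp : p ∈ u ⁻¹' Metric.ball (u p) ε := by simp [hε]
  rw [← hVe] at hp
  obtain ⟨I, w, hw, hsub⟩ := isOpen_pi_iff.1 hV p.1 hp
  refine ⟨I.sup id + 1, fun p' h => ?_⟩
  have : p' ∈ (Subtype.val : G.Play → _) ⁻¹' V := by
    apply hsub
    intro m hm
    rw [h m (Nat.lt_succ_of_le (Finset.le_sup (f := id) hm))]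
    exact (hw m hm).2
  rw [hVe] at this
  have h2 : dist (u p') (u p) < ε := this
  rwa [Real.dist_eq] at h2

open Classical in
theorem measure_through {μ : G.Profile → Measure G.Play} (hμ : G.IsInducedMeasure μ)
    (τ : G.Profile) (p : G.Play) (n : ℕ) :
    μ τ (G.through (p.1 n).1) = ∏ m ∈ Finset.range n,
      ((if (p.1 m).2 = G.playFun τ (p.1 m).1 then 1 else 0) *
        G.q (p.1 m).1 (p.1 m).2 ((p.1 (m + 1)).1)) := by
  set z := (p.1 n).1 with hz
  have hex : ∀ b : A, ∃ r : G.Play, b ∈ G.act z → (∀ m < n, r.1 m = p.1 m) ∧ r.1 n = (z, b) := by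
    intro b
    by_cases hb : b ∈ G.act z
    · choose f hf using G.act_nonempty
      obtain ⟨r, k, h1, h2⟩ := G.exists_play' (Function.update f z b) (by
        intro s
        by_cases h : s = z
        · subst h; simpa using hb
        · simpa [h] using hf s) z
      obtain ⟨h3, h4⟩ := G.play_uniq p r n k h1.symm
      subst h3
      refine ⟨r, fun _ => ⟨fun m hm => (h4 m hm).symm, ?_⟩⟩
      have := h2 n le_rfl
      rw [h1] at this
      exact Prod.ext h1 (by simpa using this)
    · exact ⟨p, fun h => absurd h hb⟩
  choose r hr using hex
  have hU : G.through z = ⋃ b ∈ G.act z, G.cylSet (r b) (n + 1) := by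
    ext p'
    simp only [Set.mem_iUnion]
    constructor
    · rintro ⟨k, hk⟩
      obtain ⟨h3, h4⟩ := G.play_uniq p p' n k hk.symm
      subst h3
      have hb : (p'.1 n).2 ∈ G.act z := by rw [← hk]; exact (p'.2.2 n).1
      refine ⟨_, hb, fun m hm => ?_⟩
      rcases Nat.lt_succ_iff_lt_or_eq.1 hm with h' | h'
      · rw [(hr _ hb).1 m h', h4 m h']
      · rw [h', (hr _ hb).2]
        exact Prod.ext hk rfl
    · rintro ⟨b, hb, h⟩
      refine ⟨n, ?_⟩
      rw [h n (Nat.lt_succ_self n), (hr b hb).2]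
  rw [hU, measure_biUnion_finset]
  · have : ∀ b ∈ G.act z, μ τ (G.cylSet (r b) (n + 1)) =
        if b = G.playFun τ z then (∏ m ∈ Finset.range n,
      ((if (p.1 m).2 = G.playFun τ (p.1 m).1 then 1 else 0) *
        G.q (p.1 m).1 (p.1 m).2 ((p.1 (m + 1)).1))) else 0 := by
      intro b hb
      rw [hμ.2 τ (r b) (n + 1), Finset.prod_range_succ]
      rw [(hr b hb).2]
      have e : ∏ m ∈ Finset.range n,
          ((if ((r b).1 m).2 = G.playFun τ ((r b).1 m).1 then (1 : ENNReal) else 0) *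
            (if m + 1 < n + 1 then G.q ((r b).1 m).1 ((r b).1 m).2 (((r b).1 (m + 1)).1) else 1))
          = (∏ m ∈ Finset.range n,
      ((if (p.1 m).2 = G.playFun τ (p.1 m).1 then 1 else 0) *
        G.q (p.1 m).1 (p.1 m).2 ((p.1 (m + 1)).1))) := by
        apply Finset.prod_congr rfl
        intro m hm
        have hm := Finset.mem_range.1 hm
        rw [(hr b hb).1 m hm, if_pos (by omega : m + 1 < n + 1)]
        have : ((r b).1 (m + 1)).1 = (p.1 (m + 1)).1 := by
          by_cases h : m + 1 < n
          · rw [(hr b hb).1 _ h]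
          · have : m + 1 = n := by omega
            rw [this, (hr b hb).2]
        rw [this]
      rw [e]
      simp
    rw [Finset.sum_congr rfl this, Finset.sum_ite_eq', if_pos (G.playFun_mem τ z)]
  · intro b hb b' hb' hne
    refine Set.disjoint_left.2 fun x hx hx' => hne ?_
    have h1 := hx n (Nat.lt_succ_self n)
    have h2 := hx' n (Nat.lt_succ_self n)
    rw [(hr b hb).2] at h1
    rw [(hr b' hb').2, h1] at h2
    exact (Prod.mk.inj h2).2
  · intro b _
    exact G.cyl_meas _ _

open Classical in
/-- A profile agreeing with `σ` below `s` and reaching `s` with positive probability. -/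
theorem exists_reaching {μ : G.Profile → Measure G.Play} (hμ : G.IsInducedMeasure μ)
    (σ : G.Profile) (s : S) : ∃ τ : G.Profile,
      (∀ z, Relation.ReflTransGen G.step s z → G.playFun τ z = G.playFun σ z) ∧
      μ τ (G.through s) ≠ 0 := by
  obtain ⟨p, n, hpn⟩ := G.through_nonempty s
  subst hpn
  let F : S → A := fun z =>
    if h : ∃ m, m < n ∧ (p.1 m).1 = z then (p.1 h.choose).2 else G.playFun σ z
  have hF : ∀ z, F z ∈ G.act z := by
    intro z
    by_cases h : ∃ m, m < n ∧ (p.1 m).1 = z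
    · simp only [F, dif_pos h]
      have := (p.2.2 h.choose).1
      rwa [h.choose_spec.2] at this
    · simp only [F, dif_neg h]
      exact G.playFun_mem _ _
  let τ : G.Profile := fun i => ⟨F, fun z _ => hF z⟩
  refine ⟨τ, ?_, ?_⟩
  · intro z hz
    change F z = _
    have : ¬ ∃ m, m < n ∧ (p.1 m).1 = z := by
      rintro ⟨m, hm, h⟩
      have := G.subtree_depth p n z hz p m h
      omega
    simp only [F, dif_neg this]
  · rw [G.measure_through hμ]
    rw [Finset.prod_ne_zero_iff]
    intro m hm
    have hm := Finset.mem_range.1 hm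
    have e : G.playFun τ (p.1 m).1 = (p.1 m).2 := by
      change F _ = _
      have h : ∃ m', m' < n ∧ (p.1 m').1 = (p.1 m).1 := ⟨m, hm, rfl⟩
      simp only [F, dif_pos h]
      rw [(G.play_uniq p p _ _ h.choose_spec.2).1]
    rw [if_pos e.symm, one_mul]
    exact (PMF.mem_support_iff _ _).1 (p.2.2 m).2

theorem measure_child {μ : G.Profile → Measure G.Play} (hμ : G.IsInducedMeasure μ)
    (τ : G.Profile) (s z : S) (hz : z ∈ (G.q s (G.playFun τ s)).support) :
    μ τ (G.through z) = μ τ (G.through s) * G.q s (G.playFun τ s) z := by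
  obtain ⟨p, n, hpn⟩ := G.through_nonempty z
  obtain ⟨k, rfl, hk⟩ := G.through_sub (G.playFun_mem τ s) hz p n hpn
  have h1 := G.measure_through hμ τ p (k + 1)
  have h2 := G.measure_through hμ τ p k
  rw [Finset.prod_range_succ, ← h2, hpn, hk] at h1
  simpa using h1

/-- `x` lies between the bounds of `u` over plays through `z`. -/
def Adm (u : G.Play → ℝ) (z : S) (x : ℝ) : Prop :=
  (∀ c, (∀ p ∈ G.through z, c ≤ u p) → c ≤ x) ∧ (∀ d, (∀ p ∈ G.through z, u p ≤ d) → x ≤ d)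

/-- One step expectation. -/
noncomputable def Qv (X : S → ℝ) (s : S) (a : A) : ℝ := ∑' z : S, ((G.q s a) z).toReal * X z

variable {G}

theorem Adm.abs_le {u : G.Play → ℝ} {z : S} {x C : ℝ} (h : G.Adm u z x)
    (hC : ∀ p, |u p| ≤ C) : |x| ≤ C :=
  _root_.abs_le.2 ⟨h.1 _ fun p _ => (_root_.abs_le.1 (hC p)).1,
    h.2 _ fun p _ => (_root_.abs_le.1 (hC p)).2⟩

theorem q_summable (s : S) (a : A) : Summable fun z => ((G.q s a) z).toReal :=
  ENNReal.summable_toReal (by rw [PMF.tsum_coe]; simp)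

theorem q_tsum (s : S) (a : A) : ∑' z, ((G.q s a) z).toReal = 1 := by
  rw [← ENNReal.tsum_toReal_eq (fun z => PMF.apply_ne_top _ _), PMF.tsum_coe]; simp

theorem Qv_summable {X : S → ℝ} {C : ℝ} (hX : ∀ z, |X z| ≤ C) (s : S) (a : A) :
    Summable fun z => ((G.q s a) z).toReal * X z := by
  refine Summable.of_norm_bounded (g := fun z => ((G.q s a) z).toReal * C)
    ((q_summable s a).mul_right C) fun z => ?_
  rw [norm_mul, Real.norm_eq_abs, Real.norm_eq_abs, abs_of_nonneg ENNReal.toReal_nonneg]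
  exact mul_le_mul_of_nonneg_left (hX z) ENNReal.toReal_nonneg

theorem Qv_const (c : ℝ) (s : S) (a : A) : G.Qv (fun _ => c) s a = c := by
  unfold Qv
  rw [tsum_mul_right, q_tsum, one_mul]

theorem Qv_mono {X Y : S → ℝ} {C D : ℝ} (hX : ∀ z, |X z| ≤ C) (hY : ∀ z, |Y z| ≤ D) (s : S) (a : A)
    (h : ∀ z ∈ (G.q s a).support, X z ≤ Y z) : G.Qv X s a ≤ G.Qv Y s a := by
  refine Summable.tsum_le_tsum (fun z => ?_) (Qv_summable hX s a) (Qv_summable hY s a)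
  by_cases hz : z ∈ (G.q s a).support
  · exact mul_le_mul_of_nonneg_left (h z hz) ENNReal.toReal_nonneg
  · rw [PMF.mem_support_iff, not_not] at hz
    simp [hz]

theorem Adm_child {u : G.Play → ℝ} {s : S} {a : A} (ha : a ∈ G.act s) {z : S}
    (hz : z ∈ (G.q s a).support) : ∀ p ∈ G.through z, p ∈ G.through s := by
  rintro p ⟨n, hn⟩
  obtain ⟨k, _, hk⟩ := G.through_sub ha hz p n hn
  exact ⟨k, by rw [hk]⟩

theorem Adm_Qv {u : G.Play → ℝ} {C : ℝ} (hC : ∀ p, |u p| ≤ C) {X : S → ℝ}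
    (hX : ∀ z, G.Adm u z (X z)) {s : S} {a : A} (ha : a ∈ G.act s) :
    G.Adm u s (G.Qv X s a) := by
  constructor
  · intro c hc
    rw [← Qv_const (G := G) c s a]
    exact Qv_mono (fun _ => le_rfl) (fun z => (hX z).abs_le hC) s a
      fun z hz => (hX z).1 c fun p hp => hc p (Adm_child (u := u) ha hz p hp)
  · intro c hc
    rw [← Qv_const (G := G) c s a]
    exact Qv_mono (fun z => (hX z).abs_le hC) (fun _ => le_rfl) s a
      fun z hz => (hX z).2 c fun p hp => hc p (Adm_child (u := u) ha hz p hp)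

theorem exists_child {f g : S → ℝ} {C : ℝ} (hf : ∀ z, |f z| ≤ C) (hg : ∀ z, |g z| ≤ C)
    (s : S) (a : A) (h1 : f s ≤ G.Qv f s a) (h2 : G.Qv g s a ≤ g s) :
    ∃ z ∈ (G.q s a).support, f s - g s ≤ f z - g z := by
  by_contra! hcon
  obtain ⟨z0, hz0⟩ := (G.q s a).support_nonempty
  have hD : ∀ z, |f z - g z| ≤ C + C := fun z => (abs_sub _ _).trans (add_le_add (hf z) (hg z))
  have e : G.Qv (fun z => f z - g z) s a = G.Qv f s a - G.Qv g s a := by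
    unfold Qv
    rw [← (Qv_summable hf s a).tsum_sub (Qv_summable hg s a)]
    simp only [mul_sub]
  have lt : G.Qv (fun z => f z - g z) s a < G.Qv (fun _ => f s - g s) s a := by
    refine Summable.tsum_lt_tsum (i := z0) (fun z => ?_) ?_ (Qv_summable hD s a)
      (Qv_summable (fun _ => le_rfl) s a)
    · by_cases hz : z ∈ (G.q s a).support
      · exact mul_le_mul_of_nonneg_left (hcon z hz).le ENNReal.toReal_nonneg
      · rw [PMF.mem_support_iff, not_not] at hz
        simp [hz]
    · refine mul_lt_mul_of_pos_left (hcon z0 hz0) ?_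
      exact ENNReal.toReal_pos ((PMF.mem_support_iff _ _).1 hz0) (PMF.apply_ne_top _ _)
  rw [Qv_const, e] at lt
  linarith

/-- Comparison principle. -/
theorem comparison {u : G.Play → ℝ} {C : ℝ} (hC : ∀ p, |u p| ≤ C) (hu : Continuous u)
    {f g : S → ℝ} (hf : ∀ z, G.Adm u z (f z)) (hg : ∀ z, G.Adm u z (g z)) (R : Set S)
    (hR : ∀ z ∈ R, ∃ a ∈ G.act z, (∀ y ∈ (G.q z a).support, y ∈ R) ∧
      f z ≤ G.Qv f z a ∧ G.Qv g z a ≤ g z) {s : S} (hs : s ∈ R) : f s ≤ g s := by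
  classical
  by_contra! hlt
  have hex : ∀ z, ∃ (a : A) (y : S), a ∈ G.act z ∧ y ∈ (G.q z a).support ∧
      (z ∈ R → y ∈ R ∧ f z - g z ≤ f y - g y) := by
    intro z
    by_cases hz : z ∈ R
    · obtain ⟨a, ha, h1, h2, h3⟩ := hR z hz
      obtain ⟨y, hy, h4⟩ := exists_child (fun z => (hf z).abs_le hC) (fun z => (hg z).abs_le hC)
        z a h2 h3
      exact ⟨a, y, ha, hy, fun _ => ⟨h1 y hy, h4⟩⟩
    · obtain ⟨a, ha⟩ := G.act_nonempty z
      obtain ⟨y, hy⟩ := (G.q z a).support_nonempty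
      exact ⟨a, y, ha, hy, fun h => absurd h hz⟩
  choose af yf h1 h2 h3 using hex
  obtain ⟨p, n, hn, hp⟩ := G.exists_play af yf h1 h2 s
  have key : ∀ m, n ≤ m → (p.1 m).1 ∈ R ∧ f s - g s ≤ f (p.1 m).1 - g (p.1 m).1 := by
    intro m hm
    induction m, hm using Nat.le_induction with
    | base => rw [hn]; exact ⟨hs, le_rfl⟩
    | succ m hm ih =>
      rw [(hp m hm).2]
      have := h3 _ ih.1
      exact ⟨this.1, ih.2.trans this.2⟩
  obtain ⟨M, hM⟩ := G.cont_cyl u hu p ((f s - g s) / 3) (by linarith)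
  have hb : ∀ p' ∈ G.through (p.1 (max n M)).1, |u p' - u p| < (f s - g s) / 3 := by
    rintro p' ⟨k, hk⟩
    obtain ⟨e1, e2⟩ := G.play_uniq p p' _ _ hk.symm
    exact hM p' fun m hm => (e2 m (lt_of_lt_of_le hm (le_max_right _ _))).symm
  have b1 := (hf (p.1 (max n M)).1).2 (u p + (f s - g s) / 3) fun p' hp' => by
    linarith [(abs_lt.1 (hb p' hp')).2]
  have b2 := (hg (p.1 (max n M)).1).1 (u p - (f s - g s) / 3) fun p' hp' => by
    linarith [(abs_lt.1 (hb p' hp')).1]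
  have := (key _ (le_max_left n M)).2
  linarith

theorem integrable_u {u : G.Play → ℝ} {C : ℝ} (hC : ∀ p, |u p| ≤ C) (hu : Continuous u)
    (m : Measure G.Play) [IsProbabilityMeasure m] : Integrable u m :=
  Integrable.of_bound hu.measurable.aestronglyMeasurable C (Filter.Eventually.of_forall hC)

theorem E_adm {μ : G.Profile → Measure G.Play} (hμ : G.IsInducedMeasure μ)
    {u : N → G.Play → ℝ} {E : G.Profile → S → N → ℝ} (hE : G.IsSubgamePayoff μ u E)
    {i : N} {C : ℝ} (hC : ∀ p, |u i p| ≤ C) (hu : Continuous (u i)) (σ : G.Profile) (s : S) :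
    G.Adm (u i) s (E σ s i) := by
  obtain ⟨τ, h1, h2⟩ := G.exists_reaching hμ σ s
  haveI := hμ.1 τ
  have h3 := hE σ τ s i h1
  have hpos : 0 < (μ τ (G.through s)).toReal := ENNReal.toReal_pos h2 (measure_ne_top _ _)
  have hint : IntegrableOn (u i) (G.through s) (μ τ) := (integrable_u hC hu (μ τ)).integrableOn
  have hc : ∀ c : ℝ, ∫ _ in G.through s, c ∂(μ τ) = c * (μ τ (G.through s)).toReal := by
    intro c
    rw [setIntegral_const, smul_eq_mul, mul_comm]; rfl
  constructor
  · intro c h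
    refine le_of_mul_le_mul_right ?_ hpos
    rw [← h3, ← hc]
    exact setIntegral_mono_on (integrable_const c).integrableOn hint (G.through_meas s) h
  · intro c h
    refine le_of_mul_le_mul_right ?_ hpos
    rw [← h3, ← hc]
    exact setIntegral_mono_on hint (integrable_const c).integrableOn (G.through_meas s) h

theorem E_step [Countable S] {μ : G.Profile → Measure G.Play} (hμ : G.IsInducedMeasure μ)
    {u : N → G.Play → ℝ} {E : G.Profile → S → N → ℝ} (hE : G.IsSubgamePayoff μ u E)
    {i : N} {C : ℝ} (hC : ∀ p, |u i p| ≤ C) (hu : Continuous (u i)) (σ : G.Profile) (s : S) :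
    E σ s i = G.Qv (fun z => E σ z i) s (G.playFun σ s) := by
  obtain ⟨τ, h1, h2⟩ := G.exists_reaching hμ σ s
  haveI := hμ.1 τ
  have h3 := hE σ τ s i h1
  have hpos : 0 < (μ τ (G.through s)).toReal := ENNReal.toReal_pos h2 (measure_ne_top _ _)
  have ea : G.playFun τ s = G.playFun σ s := h1 s .refl
  set a := G.playFun σ s with ha
  have hact : a ∈ G.act s := G.playFun_mem σ s
  let T : S → Set G.Play := fun z => {p | z ∈ (G.q s a).support ∧ p ∈ G.through z}
  have hT1 : ∀ z ∈ (G.q s a).support, T z = G.through z := fun z hz => by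
    ext p; exact ⟨fun h => h.2, fun h => ⟨hz, h⟩⟩
  have hT2 : ∀ z, z ∉ (G.q s a).support → T z = ∅ := fun z hz => by
    ext p; exact ⟨fun h => absurd h.1 hz, fun h => absurd h (Set.notMem_empty _)⟩
  have hTm : ∀ z, MeasurableSet (T z) := fun z => by
    by_cases hz : z ∈ (G.q s a).support
    · rw [hT1 z hz]; exact G.through_meas z
    · rw [hT2 z hz]; exact MeasurableSet.empty
  have hTμ : ∀ z, μ τ (T z) = μ τ (G.through s) * G.q s a z := fun z => by
    by_cases hz : z ∈ (G.q s a).support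
    · rw [hT1 z hz]
      have := G.measure_child hμ τ s z (by rw [ea]; exact hz)
      rwa [ea] at this
    · rw [hT2 z hz]
      rw [PMF.mem_support_iff, not_not] at hz
      simp [hz]
  have hTi : ∀ z, ∫ p in T z, u i p ∂(μ τ) = E σ z i * (μ τ (T z)).toReal := fun z => by
    by_cases hz : z ∈ (G.q s a).support
    · rw [hT1 z hz]
      exact hE σ τ z i fun y hy => h1 y (Relation.ReflTransGen.head ⟨a, hact, hz⟩ hy)
    · rw [hT2 z hz]
      simp
  have hdisj : Pairwise (Function.onFun Disjoint T) := by
    intro z z' hne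
    refine Set.disjoint_left.2 ?_
    rintro p ⟨hz, n, hn⟩ ⟨hz', n', hn'⟩
    obtain ⟨k, rfl, hk⟩ := G.through_sub hact hz p n hn
    obtain ⟨k', rfl, hk'⟩ := G.through_sub hact hz' p n' hn'
    have := (G.play_uniq p p k k' (by rw [hk, hk'])).1
    subst this
    exact hne (hn.symm.trans hn')
  have hsub : (⋃ z, T z) ⊆ G.through s := by
    intro p hp
    obtain ⟨z, hz, hp⟩ := Set.mem_iUnion.1 hp
    exact Adm_child (u := u i) hact hz p hp
  have hmeas : μ τ (⋃ z, T z) = μ τ (G.through s) := by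
    rw [measure_iUnion hdisj hTm]
    simp only [hTμ]
    rw [ENNReal.tsum_mul_left, PMF.tsum_coe, mul_one]
  have hae : (⋃ z, T z) =ᵐ[μ τ] G.through s :=
    ae_eq_of_subset_of_measure_ge hsub hmeas.ge
      (MeasurableSet.iUnion hTm).nullMeasurableSet (measure_ne_top _ _)
  rw [← setIntegral_congr_set hae,
    integral_iUnion hTm hdisj (integrable_u hC hu (μ τ)).integrableOn] at h3
  refine mul_right_cancel₀ hpos.ne' ?_
  rw [← h3]
  unfold Qv
  rw [← tsum_mul_right]
  refine tsum_congr fun z => ?_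
  rw [hTi, hTμ, ENNReal.toReal_mul]
  ring

/-- Bellman equations for player `i` in the game restricted to `B`. -/
structure IsBell (u : G.Play → ℝ) (B : S → Set A) (i : N) (X : S → ℝ) : Prop where
  adm : ∀ z, G.Adm u z (X z)
  own_le : ∀ z, G.ctrl z = i → ∀ a ∈ B z, G.Qv X z a ≤ X z
  own_ex : ∀ z, G.ctrl z = i → ∃ a ∈ B z, X z ≤ G.Qv X z a
  opp_ge : ∀ z, G.ctrl z ≠ i → ∀ a ∈ B z, X z ≤ G.Qv X z a
  opp_ex : ∀ z, G.ctrl z ≠ i → ∃ a ∈ B z, G.Qv X z a ≤ X z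

open Classical in
theorem exists_bell {u : G.Play → ℝ} {C : ℝ} (hC : ∀ p, |u p| ≤ C) (B : S → Set A)
    (hB : ∀ s, B s ⊆ (G.act s : Set A)) (hne : ∀ s, (B s).Nonempty) (i : N) :
    ∃ X, IsBell (G := G) u B i X := by
  let F : S → Finset A := fun s => (G.act s).filter (· ∈ B s)
  have hFmem : ∀ s a, a ∈ F s ↔ a ∈ B s := fun s a => by
    simp only [F, Finset.mem_filter]
    exact ⟨fun h => h.2, fun h => ⟨hB s h, h⟩⟩
  have hF : ∀ s, (F s).Nonempty := fun s => by
    obtain ⟨a, ha⟩ := hne s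
    exact ⟨a, (hFmem s a).2 ha⟩
  let T : (S → ℝ) → S → ℝ := fun X s =>
    if G.ctrl s = i then (F s).sup' (hF s) (G.Qv X s) else (F s).inf' (hF s) (G.Qv X s)
  have hbd : ∀ {X : S → ℝ}, (∀ z, G.Adm u z (X z)) → ∀ z, |X z| ≤ C :=
    fun h z => (h z).abs_le hC
  have hTex : ∀ X s, ∃ a ∈ F s, T X s = G.Qv X s a := by
    intro X s
    by_cases h : G.ctrl s = i
    · obtain ⟨a, ha, e⟩ := Finset.exists_mem_eq_sup' (hF s) (G.Qv X s)
      exact ⟨a, ha, by simp only [T, if_pos h, e]⟩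
    · obtain ⟨a, ha, e⟩ := Finset.exists_mem_eq_inf' (hF s) (G.Qv X s)
      exact ⟨a, ha, by simp only [T, if_neg h, e]⟩
  have hTadm : ∀ X, (∀ z, G.Adm u z (X z)) → ∀ z, G.Adm u z (T X z) := by
    intro X hX z
    obtain ⟨a, ha, e⟩ := hTex X z
    rw [e]
    exact Adm_Qv hC hX (hB z ((hFmem z a).1 ha))
  have hTmono : ∀ X Y, (∀ z, G.Adm u z (X z)) → (∀ z, G.Adm u z (Y z)) → (∀ z, X z ≤ Y z) →
      ∀ z, T X z ≤ T Y z := by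
    intro X Y hX hY h z
    have hq : ∀ a, G.Qv X z a ≤ G.Qv Y z a := fun a =>
      Qv_mono (hbd hX) (hbd hY) z a fun y _ => h y
    by_cases hz : G.ctrl z = i
    · simp only [T, if_pos hz]
      exact Finset.sup'_le _ _ fun a ha => (hq a).trans (Finset.le_sup' (G.Qv Y z) ha)
    · simp only [T, if_neg hz]
      exact Finset.le_inf' _ _ fun a ha => (Finset.inf'_le (G.Qv X z) ha).trans (hq a)
  -- the set of admissible subsolutions
  let P : Set (S → ℝ) := {Y | (∀ z, G.Adm u z (Y z)) ∧ ∀ z, Y z ≤ T Y z}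
  have hnt : ∀ z, Nonempty (G.through z) := fun z => (G.through_nonempty z).to_subtype
  have hbb : ∀ z, BddBelow (Set.range fun p : G.through z => u p.1) := fun z =>
    ⟨-C, by rintro _ ⟨p, rfl⟩; exact (abs_le.1 (hC p.1)).1⟩
  let lo : S → ℝ := fun z => ⨅ p : G.through z, u p.1
  have hlo1 : ∀ z, ∀ p ∈ G.through z, lo z ≤ u p := fun z p hp => ciInf_le (hbb z) ⟨p, hp⟩
  have hlo : ∀ z, G.Adm u z (lo z) := fun z =>
    ⟨fun c hc => le_ciInf fun p => hc p.1 p.2, fun d hd => by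
      obtain ⟨p, hp⟩ := G.through_nonempty z
      exact (hlo1 z p hp).trans (hd p hp)⟩
  have hPlo : lo ∈ P := ⟨hlo, fun z => (hTadm lo hlo z).1 _ (hlo1 z)⟩
  let X : S → ℝ := fun z => sSup ((fun Y : S → ℝ => Y z) '' P)
  have hbdd : ∀ z, BddAbove ((fun Y : S → ℝ => Y z) '' P) := fun z =>
    ⟨C, by rintro _ ⟨Y, hY, rfl⟩; exact (abs_le.1 (hbd hY.1 z)).2⟩
  have hle : ∀ Y ∈ P, ∀ z, Y z ≤ X z := fun Y hY z => le_csSup (hbdd z) ⟨Y, hY, rfl⟩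
  have hXle : ∀ z c, (∀ Y ∈ P, Y z ≤ c) → X z ≤ c := fun z c h =>
    csSup_le ⟨_, lo, hPlo, rfl⟩ (by rintro _ ⟨Y, hY, rfl⟩; exact h Y hY)
  have hX : ∀ z, G.Adm u z (X z) := fun z =>
    ⟨fun c hc => ((hlo z).1 c hc).trans (hle lo hPlo z), fun d hd =>
      hXle z d fun Y hY => (hY.1 z).2 d hd⟩
  have h1 : ∀ z, X z ≤ T X z := fun z => hXle z _ fun Y hY =>
    (hY.2 z).trans (hTmono Y X hY.1 hX (hle Y hY) z)
  have h2 : ∀ z, T X z ≤ X z := hle (T X) ⟨hTadm X hX, hTmono X (T X) hX (hTadm X hX) h1⟩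
  have h3 : ∀ z, T X z = X z := fun z => le_antisymm (h2 z) (h1 z)
  refine ⟨X, hX, ?_, ?_, ?_, ?_⟩
  · intro z hz a ha
    rw [← h3 z]
    simp only [T, if_pos hz]
    exact Finset.le_sup' (G.Qv X z) ((hFmem z a).2 ha)
  · intro z _
    obtain ⟨a, ha, e⟩ := hTex X z
    exact ⟨a, (hFmem z a).1 ha, by rw [← e, h3]⟩
  · intro z hz a ha
    rw [← h3 z]
    simp only [T, if_neg hz]
    exact Finset.inf'_le (G.Qv X z) ((hFmem z a).2 ha)
  · intro z _
    obtain ⟨a, ha, e⟩ := hTex X z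
    exact ⟨a, (hFmem z a).1 ha, by rw [← e, h3]⟩

theorem playFun_comb_own {i : N} (f : G.Strat i) (g : G.Profile) {z : S} (h : G.ctrl z = i) :
    G.playFun (G.comb i f g) z = f.1 z := by
  subst h
  have e : G.comb (G.ctrl z) f g (G.ctrl z) = f :=
    @Function.update_self N (fun j => G.Strat j) (Classical.decEq N) (G.ctrl z) f g
  unfold playFun
  rw [e]

theorem playFun_comb_opp {i : N} (f : G.Strat i) (g : G.Profile) {z : S} (h : G.ctrl z ≠ i) :
    G.playFun (G.comb i f g) z = G.playFun g z := by
  have e : G.comb i f g (G.ctrl z) = g (G.ctrl z) :=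
    @Function.update_of_ne N (fun j => G.Strat j) (Classical.decEq N) (G.ctrl z) i h f g
  unfold playFun
  rw [e]

/-- Optimal strategies from the Bellman equations. -/
theorem IsBell.own_opt {u : G.Play → ℝ} {B : S → Set A} {i : N} {X : S → ℝ}
    (h : IsBell (G := G) u B i X) (hB : ∀ s, B s ⊆ (G.act s : Set A)) :
    ∃ f : G.Strat i, ∀ z, G.ctrl z = i → f.1 z ∈ B z ∧ X z ≤ G.Qv X z (f.1 z) := by
  classical
  have : ∀ z, ∃ a, G.ctrl z = i → a ∈ B z ∧ X z ≤ G.Qv X z a := fun z => by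
    by_cases hz : G.ctrl z = i
    · obtain ⟨a, h1, h2⟩ := h.own_ex z hz
      exact ⟨a, fun _ => ⟨h1, h2⟩⟩
    · obtain ⟨a, _⟩ := G.act_nonempty z
      exact ⟨a, fun h => absurd h hz⟩
  choose f hf using this
  exact ⟨⟨f, fun z hz => hB z (hf z hz).1⟩, hf⟩

theorem IsBell.opp_opt {u : G.Play → ℝ} {B : S → Set A} {i : N} {X : S → ℝ}
    (h : IsBell (G := G) u B i X) (hB : ∀ s, B s ⊆ (G.act s : Set A)) :
    ∃ g : G.Profile, ∀ z, G.ctrl z ≠ i → G.playFun g z ∈ B z ∧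
      G.Qv X z (G.playFun g z) ≤ X z := by
  classical
  have : ∀ z, ∃ a, a ∈ G.act z ∧ (G.ctrl z ≠ i → a ∈ B z ∧ G.Qv X z a ≤ X z) := fun z => by
    by_cases hz : G.ctrl z ≠ i
    · obtain ⟨a, h1, h2⟩ := h.opp_ex z hz
      exact ⟨a, hB z h1, fun _ => ⟨h1, h2⟩⟩
    · obtain ⟨a, ha⟩ := G.act_nonempty z
      exact ⟨a, ha, fun h => absurd h hz⟩
  choose g hg1 hg2 using this
  exact ⟨fun j => ⟨g, fun z _ => hg1 z⟩, hg2⟩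

theorem IsBell.rval_eq [Countable S] {μ : G.Profile → Measure G.Play}
    (hμ : G.IsInducedMeasure μ)
    {u : N → G.Play → ℝ} {E : G.Profile → S → N → ℝ} (hE : G.IsSubgamePayoff μ u E)
    {i : N} {C : ℝ} (hC : ∀ p, |u i p| ≤ C) (hu : Continuous (u i))
    {B : S → Set A} {X : S → ℝ}
    (h : IsBell (G := G) (u i) B i X) (hB : ∀ s, B s ⊆ (G.act s : Set A)) (s : S) :
    G.rval E B s i = X s := by
  obtain ⟨f, hf⟩ := h.own_opt hB
  obtain ⟨g, hg⟩ := h.opp_opt hB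
  have hEb : ∀ σ, |E σ s i| ≤ C := fun σ => (E_adm hμ hE hC hu σ s).abs_le hC
  let f' : { f : G.Strat i //
      ∀ z, Relation.ReflTransGen (G.stepIn B) s z → G.ctrl z = i → f.1 z ∈ B z } :=
    ⟨f, fun z _ hz => (hf z hz).1⟩
  let g' : { g : G.Profile //
      ∀ z, Relation.ReflTransGen (G.stepIn B) s z → G.ctrl z ≠ i → G.playFun g z ∈ B z } :=
    ⟨g, fun z _ hz => (hg z hz).1⟩
  haveI : Nonempty { f : G.Strat i //
      ∀ z, Relation.ReflTransGen (G.stepIn B) s z → G.ctrl z = i → f.1 z ∈ B z } := ⟨f'⟩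
  haveI : Nonempty { g : G.Profile //
      ∀ z, Relation.ReflTransGen (G.stepIn B) s z → G.ctrl z ≠ i → G.playFun g z ∈ B z } := ⟨g'⟩
  have hbb : ∀ τi : { f : G.Strat i //
      ∀ z, Relation.ReflTransGen (G.stepIn B) s z → G.ctrl z = i → f.1 z ∈ B z },
      BddBelow (Set.range fun τo : { g : G.Profile //
      ∀ z, Relation.ReflTransGen (G.stepIn B) s z → G.ctrl z ≠ i → G.playFun g z ∈ B z } =>
      E (G.comb i τi.1 τo.1) s i) := fun τi =>
    ⟨-C, by rintro _ ⟨τo, rfl⟩; exact (abs_le.1 (hEb _)).1⟩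
  unfold rval
  apply le_antisymm
  · refine ciSup_le fun τi => (ciInf_le (hbb τi) g').trans ?_
    refine comparison hC hu (f := fun z => E (G.comb i τi.1 g) z i) (g := X)
      (fun z => E_adm hμ hE hC hu _ z) h.adm
      {z | Relation.ReflTransGen (G.stepIn B) s z} ?_ (s := s) .refl
    intro z hz
    have hmem : G.playFun (G.comb i τi.1 g) z ∈ B z ∧
        G.Qv X z (G.playFun (G.comb i τi.1 g) z) ≤ X z := by
      by_cases hc : G.ctrl z = i
      · rw [playFun_comb_own _ _ hc]
        exact ⟨τi.2 z hz hc, h.own_le z hc _ (τi.2 z hz hc)⟩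
      · rw [playFun_comb_opp _ _ hc]
        exact hg z hc
    refine ⟨_, hB z hmem.1, fun y hy => ?_, (E_step hμ hE hC hu _ z).le, hmem.2⟩
    exact Relation.ReflTransGen.tail hz ⟨_, hmem.1, hy⟩
  · refine le_trans (le_ciInf fun τo => ?_) (le_ciSup (f := fun τi : { f : G.Strat i //
      ∀ z, Relation.ReflTransGen (G.stepIn B) s z → G.ctrl z = i → f.1 z ∈ B z } =>
      ⨅ τo : { g : G.Profile //
      ∀ z, Relation.ReflTransGen (G.stepIn B) s z → G.ctrl z ≠ i → G.playFun g z ∈ B z },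
      E (G.comb i τi.1 τo.1) s i) ⟨C, ?_⟩ f')
    · refine comparison hC hu (f := X) (g := fun z => E (G.comb i f τo.1) z i)
        h.adm (fun z => E_adm hμ hE hC hu _ z)
        {z | Relation.ReflTransGen (G.stepIn B) s z} ?_ (s := s) .refl
      intro z hz
      have hmem : G.playFun (G.comb i f τo.1) z ∈ B z ∧
          X z ≤ G.Qv X z (G.playFun (G.comb i f τo.1) z) := by
        by_cases hc : G.ctrl z = i
        · rw [playFun_comb_own _ _ hc]
          exact hf z hc
        · rw [playFun_comb_opp _ _ hc]
          exact ⟨τo.2 z hz hc, h.opp_ge z hc _ (τo.2 z hz hc)⟩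
      refine ⟨_, hB z hmem.1, fun y hy => ?_, hmem.2, (E_step hμ hE hC hu _ z).ge⟩
      exact Relation.ReflTransGen.tail hz ⟨_, hmem.1, hy⟩
    · rintro _ ⟨τi, rfl⟩
      exact (ciInf_le (hbb τi) g').trans (abs_le.1 (hEb _)).2

theorem rval_bell [Countable S] {μ : G.Profile → Measure G.Play}
    (hμ : G.IsInducedMeasure μ)
    {u : N → G.Play → ℝ} {E : G.Profile → S → N → ℝ} (hE : G.IsSubgamePayoff μ u E)
    {i : N} {C : ℝ} (hC : ∀ p, |u i p| ≤ C) (hu : Continuous (u i))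
    {B : S → Set A} (hB : ∀ s, B s ⊆ (G.act s : Set A)) (hne : ∀ s, (B s).Nonempty) :
    IsBell (G := G) (u i) B i (fun s => G.rval E B s i) := by
  obtain ⟨X, hX⟩ := exists_bell hC B hB hne i
  have : (fun s => G.rval E B s i) = X := funext fun s => hX.rval_eq hμ hE hC hu hB s
  rw [this]
  exact hX

theorem Ak_succ_mem {E : G.Profile → S → N → ℝ} {k : ℕ} {s : S} {a : A} :
    a ∈ G.Ak E (k + 1) s ↔ a ∈ G.Ak E k s ∧
      G.Qv (fun z => G.rval E (G.Ak E k) z (G.ctrl s)) s a =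
        G.rval E (G.Ak E k) s (G.ctrl s) := Iff.rfl

theorem Ak_anti (E : G.Profile → S → N → ℝ) (s : S) : Antitone fun k => G.Ak E k s :=
  antitone_nat_of_succ_le fun _ _ ha => (Ak_succ_mem.1 ha).1

theorem Ak_sub (E : G.Profile → S → N → ℝ) (k : ℕ) (s : S) :
    G.Ak E k s ⊆ (G.act s : Set A) := fun _ ha => Ak_anti E s (Nat.zero_le k) ha

theorem Ainf_stab (E : G.Profile → S → N → ℝ) (s : S) :
    ∀ᶠ k in Filter.atTop, ∀ a ∈ G.Ak E k s, a ∈ G.Ainf E s := by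
  have h1 : ∀ᶠ k in Filter.atTop, ∀ a ∈ G.act s, a ∈ G.Ak E k s → a ∈ G.Ainf E s := by
    rw [Filter.eventually_all_finset]
    intro a _
    by_cases h : a ∈ G.Ainf E s
    · exact Filter.Eventually.of_forall fun _ _ => h
    · have : ∃ k, a ∉ G.Ak E k s := by
        by_contra! hc
        exact h (Set.mem_iInter.2 hc)
      obtain ⟨k, hk⟩ := this
      filter_upwards [Filter.eventually_ge_atTop k] with m hm hmem
      exact absurd (Ak_anti E s hm hmem) hk
  filter_upwards [h1] with k hk a ha
  exact hk a (Ak_sub E k s ha) ha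

theorem mem_Sinf_succ {E : G.Profile → S → N → ℝ} {s z : S} {a : A} (hs : s ∈ G.Sinf E)
    (ha : a ∈ G.Ainf E s) (hz : z ∈ (G.q s a).support) : z ∈ G.Sinf E :=
  Set.mem_iInter.2 fun k => Relation.ReflTransGen.tail (Set.mem_iInter.1 hs k)
    ⟨a, Set.mem_iInter.1 ha k, hz⟩

theorem of_mem_Sinf {E : G.Profile → S → N → ℝ} {s z : S} {a : A} (ha : a ∈ G.act s)
    (hz : z ∈ (G.q s a).support) (h : z ∈ G.Sinf E) : s ∈ G.Sinf E ∧ a ∈ G.Ainf E s := by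
  have : ∀ k, s ∈ G.Sk E k ∧ a ∈ G.Ak E k s := by
    intro k
    have hk : z ∈ G.Sk E k := Set.mem_iInter.1 h k
    rcases Relation.ReflTransGen.cases_tail hk with e | ⟨y, hy, b, hb, hyz⟩
    · rw [e] at hz
      exact absurd hz (G.init_not_succ _ _ ha)
    · obtain ⟨rfl, rfl⟩ := G.unique_pred _ _ _ _ _ ha (Ak_sub E k y hb) hz hyz
      exact ⟨hy, hb⟩
  exact ⟨Set.mem_iInter.2 fun k => (this k).1, Set.mem_iInter.2 fun k => (this k).2⟩

theorem Ak_nonempty [Countable S] {μ : G.Profile → Measure G.Play}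
    (hμ : G.IsInducedMeasure μ)
    {u : N → G.Play → ℝ} {E : G.Profile → S → N → ℝ} (hE : G.IsSubgamePayoff μ u E)
    (hC : ∀ i, ∃ C, ∀ p, |u i p| ≤ C) (hu : ∀ i, Continuous (u i)) (k : ℕ) :
    ∀ s, (G.Ak E k s).Nonempty := by
  induction k with
  | zero => exact fun s => G.act_nonempty s
  | succ k ih =>
    intro s
    obtain ⟨C, hC⟩ := hC (G.ctrl s)
    have hb := rval_bell hμ hE hC (hu (G.ctrl s)) (Ak_sub E k) ih
    obtain ⟨a, ha, h⟩ := hb.own_ex s rfl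
    exact ⟨a, Ak_succ_mem.2 ⟨ha, le_antisymm (hb.own_le s rfl a ha) h⟩⟩

/-- All facts about the limit value `w` of the elimination procedure. -/
theorem exists_limit [Countable S] {μ : G.Profile → Measure G.Play}
    (hμ : G.IsInducedMeasure μ)
    {u : N → G.Play → ℝ} {E : G.Profile → S → N → ℝ} (hE : G.IsSubgamePayoff μ u E)
    (hC : ∀ i, ∃ C, ∀ p, |u i p| ≤ C) (hu : ∀ i, Continuous (u i)) (i : N) :
    ∃ w : S → ℝ, IsBell (G := G) (u i) (G.Ainf E) i w ∧
      (∀ z, G.ctrl z = i → ∀ a ∈ G.Ainf E z, G.Qv w z a = w z) ∧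
      (∀ z, G.ctrl z = i → ∀ a ∈ G.act z,
        G.Qv (fun y => G.rval E (G.Ak E 0) y i) z a ≤ w z) := by
  have hne := fun k => Ak_nonempty hμ hE hC hu k
  obtain ⟨C, hC⟩ := hC i
  have hu := hu i
  let v : ℕ → S → ℝ := fun k s => G.rval E (G.Ak E k) s i
  have hb : ∀ k, IsBell (G := G) (u i) (G.Ak E k) i (v k) := fun k =>
    rval_bell hμ hE hC hu (Ak_sub E k) (hne k)
  have hvb : ∀ k z, |v k z| ≤ C := fun k z => ((hb k).adm z).abs_le hC
  have hown : ∀ k z, G.ctrl z = i → ∀ a ∈ G.Ak E (k + 1) z, G.Qv (v k) z a = v k z := by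
    rintro k z rfl a ha
    exact (Ak_succ_mem.1 ha).2
  have hmono1 : ∀ k s, v k s ≤ v (k + 1) s := by
    intro k s
    refine comparison hC hu (hb k).adm (hb (k + 1)).adm Set.univ ?_ (Set.mem_univ s)
    intro z _
    by_cases hz : G.ctrl z = i
    · obtain ⟨a, ha⟩ := hne (k + 1) z
      exact ⟨a, Ak_sub E _ z ha, fun _ _ => Set.mem_univ _, (hown k z hz a ha).ge,
        (hb (k + 1)).own_le z hz a ha⟩
    · obtain ⟨a, ha, h⟩ := (hb (k + 1)).opp_ex z hz
      exact ⟨a, Ak_sub E _ z ha, fun _ _ => Set.mem_univ _,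
        (hb k).opp_ge z hz a (Ak_succ_mem.1 ha).1, h⟩
  have hmono : ∀ s, Monotone fun k => v k s := fun s => monotone_nat_of_le_succ fun k => hmono1 k s
  have hbdd : ∀ s, BddAbove (Set.range fun k => v k s) := fun s =>
    ⟨C, by rintro _ ⟨k, rfl⟩; exact (abs_le.1 (hvb k s)).2⟩
  let w : S → ℝ := fun s => ⨆ k, v k s
  have hlim : ∀ s, Filter.Tendsto (fun k => v k s) Filter.atTop (nhds (w s)) := fun s =>
    tendsto_atTop_ciSup (hmono s) (hbdd s)
  have hle : ∀ k s, v k s ≤ w s := fun k s => le_ciSup (hbdd s) k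
  have hQlim : ∀ s a, Filter.Tendsto (fun k => G.Qv (v k) s a) Filter.atTop
      (nhds (G.Qv w s a)) := by
    intro s a
    refine tendsto_tsum_of_dominated_convergence (bound := fun z => ((G.q s a) z).toReal * C)
      ((q_summable s a).mul_right C) (fun z => (hlim z).const_mul _) ?_
    refine Filter.Eventually.of_forall fun k z => ?_
    rw [norm_mul, Real.norm_eq_abs, Real.norm_eq_abs, abs_of_nonneg ENNReal.toReal_nonneg]
    exact mul_le_mul_of_nonneg_left (hvb k z) ENNReal.toReal_nonneg
  have hinf : ∀ {k z a}, a ∈ G.Ainf E z → a ∈ G.Ak E k z := fun h => Set.mem_iInter.1 h _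
  have hwown : ∀ z, G.ctrl z = i → ∀ a ∈ G.Ainf E z, G.Qv w z a = w z := by
    intro z hz a ha
    refine tendsto_nhds_unique (hQlim z a) ?_
    simp only [hown _ z hz a (hinf ha)]
    exact hlim z
  have hAne : ∀ z, (G.Ainf E z).Nonempty := fun z => by
    obtain ⟨k, hk⟩ := (Ainf_stab E z).exists
    obtain ⟨a, ha⟩ := hne k z
    exact ⟨a, hk a ha⟩
  refine ⟨w, ⟨?_, ?_, ?_, ?_, ?_⟩, hwown, ?_⟩
  · exact fun z => ⟨fun c hc => (((hb 0).adm z).1 c hc).trans (hle 0 z),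
      fun d hd => ciSup_le fun k => ((hb k).adm z).2 d hd⟩
  · exact fun z hz a ha => (hwown z hz a ha).le
  · intro z hz
    obtain ⟨a, ha⟩ := hAne z
    exact ⟨a, ha, (hwown z hz a ha).ge⟩
  · intro z hz a ha
    exact le_of_tendsto_of_tendsto' (hlim z) (hQlim z a) fun k => (hb k).opp_ge z hz a (hinf ha)
  · intro z hz
    by_contra! hcon
    have h1 : ∀ᶠ k in Filter.atTop, ∀ a ∈ G.act z, a ∈ G.Ainf E z → v k z < G.Qv (v k) z a := by
      rw [Filter.eventually_all_finset]
      intro a _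
      by_cases h : a ∈ G.Ainf E z
      · filter_upwards [(hlim z).eventually_lt (hQlim z a) (hcon a h)] with k hk _ using hk
      · exact Filter.Eventually.of_forall fun _ h' => absurd h' h
    obtain ⟨k, hk1, hk2⟩ := (h1.and (Ainf_stab E z)).exists
    obtain ⟨a, ha, h⟩ := (hb k).opp_ex z hz
    exact absurd h (not_le.2 (hk1 a (Ak_sub E k z ha) (hk2 a ha)))
  · intro z hz a ha
    have h0 : a ∈ G.Ak E 0 z := ha
    exact ((hb 0).own_le z hz a h0).trans (hle 0 z)

end Aux

end PGame

/-- **Deviating inside `G^∞` does not profit** (Lemma 7): with the punishment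
profile `τ` built from `ρ*`, `L`, `σ_{-i}` and `σ^∞_{-i}`, for every player `i`,
every strategy `τ'_i` of player `i` and every state `s ∈ S^∞` controlled by `i`
with `L(s) = ⊥` and `τ'_i(s) ∈ A^∞(s) ∖ {ρ*_i(s)}`, one has
`u_i(τ'_i, τ_{-i} | s) ≤ u_i(τ | s)`. -/
theorem deviation_inside_limit_game_not_better
    {N S A : Type*} [Fintype N] [DecidableEq N] [Countable S]
    (hN : 2 ≤ Fintype.card N)
    (G : PGame N S A) (u : N → G.Play → ℝ)
    (hu_bdd : ∀ i : N, ∃ C : ℝ, ∀ p : G.Play, |u i p| ≤ C)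
    (hu_cont : ∀ i : N, Continuous (u i))
    (μ : G.Profile → MeasureTheory.Measure G.Play)
    (hμ : G.IsInducedMeasure μ)
    (E : G.Profile → S → N → ℝ)
    (hE : G.IsSubgamePayoff μ u E)
    -- for every player `i`, `σm i` is an opponent profile `σ_{-i}` that punishes
    -- player `i` down to the value `v_i(s)` in every subgame `G(s)`
    (σm : N → G.Profile)
    (hσm : ∀ (i : N) (s : S) (τi : G.Strat i),
        E (G.comb i τi (σm i)) s i ≤ G.rval E (G.Ak E 0) s i)
    -- for every player `i`, `σinf i` is an opponent profile `σ^∞_{-i}` playing only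
    -- actions of `G^∞`, punishing player `i` down to `v^∞_i(s)` in every subgame of
    -- `G^∞`
    (σinf : N → G.Profile)
    (hσinf_in : ∀ (i j : N) (s : S), s ∈ G.Sinf E → j ≠ i → G.ctrl s = j →
        ((σinf i) j).1 s ∈ G.Ainf E s)
    (hσinf : ∀ (i : N), ∀ s ∈ G.Sinf E, ∀ τi : G.Strat i,
        (∀ z ∈ G.Sinf E, G.ctrl z = i → τi.1 z ∈ G.Ainf E z) →
        E (G.comb i τi (σinf i)) s i ≤ G.rval E (G.Ainf E) s i)
    -- `ρ` is a strategy profile `ρ*` of `G^∞` minimizing the sum of the expected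
    -- payoffs of all players over all strategy profiles of `G^∞`
    (ρ : G.Profile)
    (hρ_in : ∀ s ∈ G.Sinf E, G.playFun ρ s ∈ G.Ainf E s)
    (hρ_min : ∀ ρ' : G.Profile, (∀ s ∈ G.Sinf E, G.playFun ρ' s ∈ G.Ainf E s) →
        ∑ i : N, G.epay μ u ρ i ≤ ∑ i : N, G.epay μ u ρ' i)
    -- `L` records the first player who deviated from `ρ*` (`none` = `⊥`, nobody)
    (L : S → Option N)
    (hL_init : L G.init = none)
    (hL : ∀ (s : S) (a : A), a ∈ G.act s → ∀ z ∈ (G.q s a).support,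
        (L s = none → G.playFun ρ s = a → L z = none) ∧
        (L s = none → G.playFun ρ s ≠ a → L z = some (G.ctrl s)) ∧
        (L s ≠ none → L z = L s))
    -- `τ` is the punishment profile: follow `ρ*` as long as nobody deviated; once
    -- player `i` has deviated, punish him with `σ^∞_{-i}` inside `S^∞` and with
    -- `σ_{-i}` outside `S^∞` (the deviator himself plays inside `A^∞` on `S^∞`)
    (τ : G.Profile)
    (hτ_follow : ∀ s : S, L s = none → G.playFun τ s = G.playFun ρ s)
    (hτ_dev : ∀ s : S, L s = some (G.ctrl s) → s ∈ G.Sinf E →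
        G.playFun τ s ∈ G.Ainf E s)
    (hτ_pun_inf : ∀ (s : S) (i : N), L s = some i → i ≠ G.ctrl s → s ∈ G.Sinf E →
        G.playFun τ s = G.playFun (σinf i) s)
    (hτ_pun_out : ∀ (s : S) (i : N), L s = some i → i ≠ G.ctrl s → s ∉ G.Sinf E →
        G.playFun τ s = G.playFun (σm i) s) :
    ∀ (i : N) (τ'i : G.Strat i) (s : S), s ∈ G.Sinf E → G.ctrl s = i →
      L s = none → τ'i.1 s ∈ G.Ainf E s → τ'i.1 s ≠ G.playFun ρ s →
      E (G.comb i τ'i τ) s i ≤ E τ s i := by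
  classical
  intro i τ'i s hs hci hLs hmem hneρ
  obtain ⟨C, hC⟩ := hu_bdd i
  have hu := hu_cont i
  obtain ⟨w, hw, hwown, hwout⟩ := PGame.exists_limit hμ hE hu_bdd hu_cont i
  have hA0 : ∀ s, G.Ak E 0 s ⊆ (G.act s : Set A) := PGame.Ak_sub E 0
  have hAinf : ∀ s, G.Ainf E s ⊆ (G.act s : Set A) := fun s a ha =>
    hA0 s (Set.mem_iInter.1 ha 0)
  have hv := PGame.rval_bell hμ hE hC hu hA0 (fun s => G.act_nonempty s)
  set v : S → ℝ := fun y => G.rval E (G.Ak E 0) y i with hvdef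
  have hrw : ∀ z, G.rval E (G.Ainf E) z i = w z := hw.rval_eq hμ hE hC hu hAinf
  have hEadm : ∀ σ z, G.Adm (u i) z (E σ z i) := fun σ z => PGame.E_adm hμ hE hC hu σ z
  have hEstep : ∀ σ z, E σ z i = G.Qv (fun y => E σ y i) z (G.playFun σ z) := fun σ z =>
    PGame.E_step hμ hE hC hu σ z
  have hwQ : ∀ z, ∀ a ∈ G.Ainf E z, w z ≤ G.Qv w z a := by
    intro z a ha
    by_cases hz : G.ctrl z = i
    · exact (hwown z hz a ha).ge
    · exact hw.opp_ge z hz a ha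
  -- every profile of the limit game guarantees `w`
  have hlow : ∀ σ : G.Profile, (∀ z ∈ G.Sinf E, G.playFun σ z ∈ G.Ainf E z) →
      ∀ z ∈ G.Sinf E, w z ≤ E σ z i := by
    intro σ hσ z hz
    refine PGame.comparison hC hu hw.adm (hEadm σ) (G.Sinf E) ?_ hz
    intro y hy
    exact ⟨_, hAinf y (hσ y hy), fun x hx => PGame.mem_Sinf_succ hy (hσ y hy) hx,
      hwQ y _ (hσ y hy), (hEstep σ y).ge⟩
  -- `σinf` is one-step optimal
  have hpinf : ∀ z ∈ G.Sinf E, G.ctrl z ≠ i → G.Qv w z (G.playFun (σinf i) z) ≤ w z := by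
    intro z hz hc
    have hin : ∀ y ∈ G.Sinf E, G.playFun (G.comb i (ρ i) (σinf i)) y ∈ G.Ainf E y := by
      intro y hy
      by_cases hyc : G.ctrl y = i
      · rw [PGame.playFun_comb_own _ _ hyc]
        have := hρ_in y hy
        unfold PGame.playFun at this
        rwa [hyc] at this
      · rw [PGame.playFun_comb_opp _ _ hyc]
        exact hσinf_in i _ y hy hyc rfl
    have h1 := hσinf i z hz (ρ i) (by
      intro y hy hyc
      have := hin y hy
      rwa [PGame.playFun_comb_own _ _ hyc] at this)
    rw [hrw, hEstep, PGame.playFun_comb_opp _ _ hc] at h1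
    refine le_trans ?_ h1
    have hza : G.playFun (σinf i) z ∈ G.Ainf E z := hσinf_in i _ z hz hc rfl
    exact PGame.Qv_mono (fun y => (hw.adm y).abs_le hC) (fun y => (hEadm _ y).abs_le hC) z _
      fun y hy => hlow _ hin y (PGame.mem_Sinf_succ hz hza hy)
  -- `σm` is one-step optimal
  obtain ⟨f, hf⟩ := hv.own_opt hA0
  have hpout : ∀ z, G.ctrl z ≠ i → G.Qv v z (G.playFun (σm i) z) ≤ v z := by
    intro z hc
    have h1 := hσm i z f
    rw [hEstep, PGame.playFun_comb_opp _ _ hc] at h1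
    refine le_trans ?_ h1
    refine PGame.Qv_mono (fun y => (hv.adm y).abs_le hC) (fun y => (hEadm _ y).abs_le hC) z _
      fun y hy => ?_
    refine PGame.comparison hC hu hv.adm (hEadm _) Set.univ ?_ (Set.mem_univ y)
    intro x _
    refine ⟨_, G.playFun_mem (G.comb i f (σm i)) x, fun _ _ => Set.mem_univ _, ?_,
      (hEstep _ x).ge⟩
    by_cases hx : G.ctrl x = i
    · rw [PGame.playFun_comb_own _ _ hx]
      exact (hf x hx).2
    · rw [PGame.playFun_comb_opp _ _ hx]
      exact hv.opp_ge x hx _ (G.playFun_mem _ x)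
  -- following `τ` yields at least `w`
  have hlower : w s ≤ E τ s i := by
    refine PGame.comparison hC hu hw.adm (hEadm τ) {z | z ∈ G.Sinf E ∧ L z = none} ?_ ⟨hs, hLs⟩
    rintro z ⟨hz, hLz⟩
    have hm : G.playFun τ z ∈ G.Ainf E z := by
      rw [hτ_follow z hLz]; exact hρ_in z hz
    exact ⟨_, hAinf z hm, fun y hy => ⟨PGame.mem_Sinf_succ hz hm hy,
      (hL z _ (hAinf z hm) y hy).1 hLz (hτ_follow z hLz).symm⟩, hwQ z _ hm, (hEstep τ z).ge⟩
  refine le_trans ?_ hlower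
  -- the potential bounding the deviator
  let W : S → ℝ := fun z => if z ∈ G.Sinf E then w z else v z
  have hWin : ∀ z ∈ G.Sinf E, W z = w z := fun z hz => if_pos hz
  have hWout : ∀ z, z ∉ G.Sinf E → W z = v z := fun z hz => if_neg hz
  have hWadm : ∀ z, G.Adm (u i) z (W z) := by
    intro z
    by_cases hz : z ∈ G.Sinf E
    · rw [hWin z hz]; exact hw.adm z
    · rw [hWout z hz]; exact hv.adm z
  have hQin : ∀ z ∈ G.Sinf E, ∀ a ∈ G.Ainf E z, G.Qv W z a ≤ G.Qv w z a := by
    intro z hz a ha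
    exact PGame.Qv_mono (fun y => (hWadm y).abs_le hC) (fun y => (hw.adm y).abs_le hC) z a
      fun y hy => (hWin y (PGame.mem_Sinf_succ hz ha hy)).le
  have hQout : ∀ z, ∀ a ∈ G.act z, (z ∉ G.Sinf E ∨ a ∉ G.Ainf E z) →
      G.Qv W z a ≤ G.Qv v z a := by
    intro z a ha h
    refine PGame.Qv_mono (fun y => (hWadm y).abs_le hC) (fun y => (hv.adm y).abs_le hC) z a
      fun y hy => (hWout y fun hyS => ?_).le
    have := PGame.of_mem_Sinf ha hy hyS
    rcases h with h | h
    · exact h this.1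
    · exact h this.2
  rw [← hWin s hs]
  refine PGame.comparison hC hu (hEadm (G.comb i τ'i τ)) hWadm {z | z = s ∨ L z = some i} ?_
    (Or.inl rfl)
  intro z hz
  refine ⟨_, G.playFun_mem (G.comb i τ'i τ) z, ?_, (hEstep _ z).le, ?_⟩
  · intro y hy
    right
    have hLy := hL z _ (G.playFun_mem (G.comb i τ'i τ) z) y hy
    rcases hz with rfl | hz
    · rw [← hci]
      refine hLy.2.1 hLs fun h => hneρ ?_
      rw [h, PGame.playFun_comb_own _ _ hci]
    · rw [hLy.2.2 (by rw [hz]; simp), hz]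
  · by_cases hc : G.ctrl z = i
    · rw [PGame.playFun_comb_own _ _ hc]
      have hact : τ'i.1 z ∈ G.act z := τ'i.2 z hc
      by_cases hzS : z ∈ G.Sinf E
      · rw [hWin z hzS]
        by_cases ha : τ'i.1 z ∈ G.Ainf E z
        · exact (hQin z hzS _ ha).trans (hwown z hc _ ha).le
        · exact (hQout z _ hact (Or.inr ha)).trans (hwout z hc _ hact)
      · rw [hWout z hzS]
        exact (hQout z _ hact (Or.inl hzS)).trans (hv.own_le z hc _ hact)
    · rw [PGame.playFun_comb_opp _ _ hc]
      have hLz : L z = some i := by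
        rcases hz with rfl | hz
        · exact absurd hci hc
        · exact hz
      by_cases hzS : z ∈ G.Sinf E
      · rw [hWin z hzS, hτ_pun_inf z i hLz (Ne.symm hc) hzS]
        exact (hQin z hzS _ (hσinf_in i _ z hzS hc rfl)).trans (hpinf z hzS hc)
      · rw [hWout z hzS, hτ_pun_out z i hLz (Ne.symm hc) hzS]
        exact (hQout z _ (G.playFun_mem _ z) (Or.inl hzS)).trans (hpout z hc)
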